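/- Exponential transformation of the Fokker–Planck equation (forward direction): Let σ > 0, let b₊ : ℝⁿ × ℝ → ℝⁿ be continuously differentiable in x, and let ρ : ℝⁿ × ℝ → ℝ be everywhere strictly positive, twice continuously differentiable in x and once in t, and satisfy the Fokker–Planck equation ∂ρ/∂t + ∇·(b₊ρ) = (σ²/2)Δρ at every (x,t). Define the backward drift b₋ := b₊ − σ²∇log ρ. Let φ : ℝⁿ × ℝ → ℝ be twice continuously differentiable in x and once in t and satisfy ∂φ/∂t + b₋·∇φ − (σ²/2)Δφ = −(σ²/2)∇φ·∇φ at every (x,t). Then the function ρ̃ := exp(−φ)·ρ also satisfies the Fokker–Planck equation ∂ρ̃/∂t + ∇·(b₊ρ̃) = (σ²/2)Δρ̃ at every (x,t). -/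

import Mathlib

/-- Spatial partial derivative in direction `i` of a function `f(x,t)` on `ℝⁿ × ℝ`. -/
noncomputable def pd {n : ℕ} (i : Fin n) (f : (Fin n → ℝ) → ℝ → ℝ) :
    (Fin n → ℝ) → ℝ → ℝ :=
  fun x t => fderiv ℝ (fun y => f y t) x (Pi.single i 1)

theorem pd_mul {n : ℕ} (i : Fin n) {f g : (Fin n → ℝ) → ℝ → ℝ} {x : Fin n → ℝ} {t : ℝ}
    (hf : DifferentiableAt ℝ (fun y => f y t) x) (hg : DifferentiableAt ℝ (fun y => g y t) x) :
    pd i (fun y s => f y s * g y s) x t = f x t * pd i g x t + g x t * pd i f x t := by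
  simp [pd, fderiv_fun_mul hf hg]

theorem pd_sub {n : ℕ} (i : Fin n) {f g : (Fin n → ℝ) → ℝ → ℝ} {x : Fin n → ℝ} {t : ℝ}
    (hf : DifferentiableAt ℝ (fun y => f y t) x) (hg : DifferentiableAt ℝ (fun y => g y t) x) :
    pd i (fun y s => f y s - g y s) x t = pd i f x t - pd i g x t := by
  simp [pd, fderiv_fun_sub hf hg]

theorem pd_exp_neg {n : ℕ} (i : Fin n) {f : (Fin n → ℝ) → ℝ → ℝ} {x : Fin n → ℝ} {t : ℝ}
    (hf : DifferentiableAt ℝ (fun y => f y t) x) :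
    pd i (fun y s => Real.exp (-f y s)) x t = -(Real.exp (-f x t) * pd i f x t) := by
  simp [pd, fderiv_exp hf.fun_neg]

theorem pd_log {n : ℕ} (i : Fin n) {f : (Fin n → ℝ) → ℝ → ℝ} {x : Fin n → ℝ} {t : ℝ}
    (hf : DifferentiableAt ℝ (fun y => f y t) x) (hx : f x t ≠ 0) :
    pd i (fun y s => Real.log (f y s)) x t = (f x t)⁻¹ * pd i f x t := by
  simp [pd, fderiv.log hf hx]

theorem differentiable_pd {n : ℕ} (i : Fin n) {f : (Fin n → ℝ) → ℝ → ℝ} {t : ℝ}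
    (hf : ContDiff ℝ 2 (fun y => f y t)) : Differentiable ℝ (fun y => pd i f y t) :=
  ((hf.fderiv_right (m := 1) (by norm_num)).differentiable (by norm_num)).clm_apply
    (differentiable_const _)

theorem pd_exp_neg_mul {n : ℕ} (i : Fin n) {f g : (Fin n → ℝ) → ℝ → ℝ} {x : Fin n → ℝ} {t : ℝ}
    (hf : DifferentiableAt ℝ (fun y => f y t) x) (hg : DifferentiableAt ℝ (fun y => g y t) x) :
    pd i (fun y s => Real.exp (-f y s) * g y s) x t
      = Real.exp (-f x t) * (pd i g x t - g x t * pd i f x t) := by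
  rw [pd_mul i hf.fun_neg.exp hg, pd_exp_neg i hf]
  ring

theorem pd_pd_exp_neg_mul {n : ℕ} (i : Fin n) {f g : (Fin n → ℝ) → ℝ → ℝ}
    (hf : ∀ t, ContDiff ℝ 2 (fun y => f y t)) (hg : ∀ t, ContDiff ℝ 2 (fun y => g y t))
    (x : Fin n → ℝ) (t : ℝ) :
    pd i (pd i fun y s => Real.exp (-f y s) * g y s) x t
      = Real.exp (-f x t) * (pd i (pd i g) x t - 2 * (pd i g x t * pd i f x t)
        + g x t * (pd i f x t * pd i f x t) - g x t * pd i (pd i f) x t) := by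
  have df : ∀ t, Differentiable ℝ (fun y => f y t) := fun t => (hf t).differentiable (by norm_num)
  have dg : ∀ t, Differentiable ℝ (fun y => g y t) := fun t => (hg t).differentiable (by norm_num)
  have df' := differentiable_pd i (hf t) x
  have dg' := differentiable_pd i (hg t) x
  have h : (pd i fun y s => Real.exp (-f y s) * g y s)
      = fun y s => Real.exp (-f y s) * (pd i g y s - g y s * pd i f y s) := by
    funext y s
    exact pd_exp_neg_mul i (df s y) (dg s y)
  rw [h, pd_exp_neg_mul i (g := fun y s => pd i g y s - g y s * pd i f y s) (df t x)
      (dg'.fun_sub ((dg t x).fun_mul df')),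
    pd_sub i (f := pd i g) (g := fun y s => g y s * pd i f y s) dg' ((dg t x).fun_mul df'),
    pd_mul i (dg t x) df']
  ring

/-- Exponential transformation of the Fokker–Planck equation (forward direction):
if the strictly positive density `ρ` satisfies the Fokker–Planck equation
`∂ρ/∂t + ∇·(b₊ρ) = (σ²/2)Δρ`, the backward drift is `b₋ = b₊ − σ²∇log ρ`, and `φ`
satisfies `∂φ/∂t + b₋·∇φ − (σ²/2)Δφ = −(σ²/2)∇φ·∇φ`, then `ρ̃ = exp(−φ)·ρ` also
satisfies the Fokker–Planck equation. -/
theorem fokker_planck_exp_transform {n : ℕ} (σ : ℝ) (hσ : 0 < σ)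
    (b : Fin n → (Fin n → ℝ) → ℝ → ℝ)
    (hb : ∀ i t, ContDiff ℝ 1 (fun x => b i x t))
    (ρ : (Fin n → ℝ) → ℝ → ℝ)
    (hρpos : ∀ x t, 0 < ρ x t)
    (hρx : ∀ t, ContDiff ℝ 2 (fun x => ρ x t))
    (hρt : ∀ x, ContDiff ℝ 1 (fun t => ρ x t))
    (hFP : ∀ x t, deriv (fun s => ρ x s) t
        + ∑ i, pd i (fun y s => b i y s * ρ y s) x t
        = σ ^ 2 / 2 * ∑ i, pd i (pd i ρ) x t)
    (φ : (Fin n → ℝ) → ℝ → ℝ)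
    (hφx : ∀ t, ContDiff ℝ 2 (fun x => φ x t))
    (hφt : ∀ x, ContDiff ℝ 1 (fun t => φ x t))
    (hφPDE : ∀ x t, deriv (fun s => φ x s) t
        + ∑ i, (b i x t - σ ^ 2 * pd i (fun y s => Real.log (ρ y s)) x t) * pd i φ x t
        - σ ^ 2 / 2 * ∑ i, pd i (pd i φ) x t
        = -(σ ^ 2 / 2) * ∑ i, pd i φ x t * pd i φ x t) :
    ∀ x t, deriv (fun s => Real.exp (-φ x s) * ρ x s) t
        + ∑ i, pd i (fun y s => b i y s * (Real.exp (-φ y s) * ρ y s)) x t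
        = σ ^ 2 / 2 * ∑ i, pd i (pd i fun y s => Real.exp (-φ y s) * ρ y s) x t := by
  intro x t
  have dφ : Differentiable ℝ (fun y => φ y t) := (hφx t).differentiable (by norm_num)
  have dρ : Differentiable ℝ (fun y => ρ y t) := (hρx t).differentiable (by norm_num)
  have db : ∀ i, Differentiable ℝ (fun y => b i y t) := fun i =>
    (hb i t).differentiable (by norm_num)
  have hρ0 : ρ x t ≠ 0 := (hρpos x t).ne'
  have time : deriv (fun s => Real.exp (-φ x s) * ρ x s) t
      = Real.exp (-φ x t) * (deriv (fun s => ρ x s) t - ρ x t * deriv (fun s => φ x s) t) := by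
    have hφd := ((hφt x).differentiable (by norm_num) t).hasDerivAt
    have hρd := ((hρt x).differentiable (by norm_num) t).hasDerivAt
    rw [(hφd.fun_neg.exp.fun_mul hρd).deriv]
    ring
  have drift : ∀ i, pd i (fun y s => b i y s * (Real.exp (-φ y s) * ρ y s)) x t
      = Real.exp (-φ x t) * (pd i (fun y s => b i y s * ρ y s) x t
        - ρ x t * (b i x t * pd i φ x t)) := by
    intro i
    rw [pd_mul i (g := fun y s => Real.exp (-φ y s) * ρ y s) (db i x)
        ((dφ x).fun_neg.exp.fun_mul (dρ x)),
      pd_exp_neg_mul i (dφ x) (dρ x), pd_mul i (db i x) (dρ x)]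
    ring
  have backward : ∀ i, (b i x t - σ ^ 2 * pd i (fun y s => Real.log (ρ y s)) x t) * pd i φ x t
      = b i x t * pd i φ x t - σ ^ 2 * (ρ x t)⁻¹ * (pd i ρ x t * pd i φ x t) := by
    intro i
    rw [pd_log i (dρ x) hρ0]
    ring
  have hF := hFP x t
  have hP := hφPDE x t
  simp only [backward] at hP
  simp only [time, drift, pd_pd_exp_neg_mul _ hφx hρx]
  simp only [Finset.sum_add_distrib, Finset.sum_sub_distrib, ← Finset.mul_sum] at hP ⊢
  have hc : ρ x t * (ρ x t)⁻¹ = 1 := mul_inv_cancel₀ hρ0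
  linear_combination Real.exp (-φ x t) * hF - Real.exp (-φ x t) * ρ x t * hP
    - Real.exp (-φ x t) * σ ^ 2 * (∑ i, pd i ρ x t * pd i φ x t) * hc
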